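/- Let S₁ and S₂ be sets of origin graphs over finite alphabets Σ and Γ. Then S₁ ⪯ S₂ (there exists a bounded regular resynchronizer R with S₁ ⊆ R(S₂)) if and only if there exists k ∈ ℕ such that for every σ' ∈ S₁ there exists σ ∈ S₂ with the same input and output words such that the pair (σ, σ') has k-traversal. (The paper states this for the origin semantics of two-way nondeterministic transducers; the proof establishes it for arbitrary sets of origin graphs.) -/

import Mathlib

/-- An annotated letter over `Σ × {0,1}^(m+2)`: an input letter together with `m`
parameter bits and two marker bits (for the source position `x` and target position `y`). -/
abbrev RLetter (Sig : Type) (m : ℕ) : Type :=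
  Sig × (Fin m → Bool) × Bool × Bool

/-- The word over `Σ × {0,1}^(m+2)` annotating `u` with the parameter valuation `Ī`
(positions are 1-indexed, parameters given by their characteristic functions) and with
marker bits at positions `x` and `y`. -/
def annot {Sig : Type} {m : ℕ} (u : List Sig) (I : Fin m → ℕ → Bool)
    (x y : ℕ) : List (RLetter Sig m) :=
  u.mapIdx fun j a => (a, fun i => I i (j + 1), decide (j + 1 = x), decide (j + 1 = y))

/-- `(u, Ī, x, y) ⊨ γ`. -/
def RSat {Sig : Type} {m : ℕ} (γ : Set (List (RLetter Sig m)))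
    (u : List Sig) (I : Fin m → ℕ → Bool) (x y : ℕ) : Prop :=
  annot u I x y ∈ γ

/-- A language is regular if it is accepted by a deterministic finite automaton. -/
def IsRegularLang {α : Type} (L : Set (List α)) : Prop :=
  ∃ (Q : Type) (_ : Fintype Q) (M : DFA α Q), M.accepts = L

/-- A resynchronizer (given by its language `γ` with `m` input parameters) is bounded by `k`
if for every input word `u`, parameters `Ī` and position `y` of `u`, there are at most `k`
distinct positions `x` of `u` with `(u, Ī, x, y) ⊨ γ`. -/
def BoundedBy {Sig : Type} {m : ℕ} (γ : Set (List (RLetter Sig m))) (k : ℕ) : Prop :=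
  ∀ (u : List Sig) (I : Fin m → ℕ → Bool) (y : ℕ), 1 ≤ y → y ≤ u.length →
    {x : ℕ | 1 ≤ x ∧ x ≤ u.length ∧ RSat γ u I x y}.ncard ≤ k

/-- A resynchronizer is bounded if it is bounded by some `k`. -/
def BoundedResync {Sig : Type} {m : ℕ} (γ : Set (List (RLetter Sig m))) : Prop :=
  ∃ k, BoundedBy γ k

/-- An origin graph: a nonempty input word `u`, an output word `v`, and an origin map
sending every (1-indexed) position of `v` to a position of `u`. -/
structure OriginGraph (Sig Gam : Type) where
  inp : List Sig
  out : List Gam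
  orig : ℕ → ℕ
  inp_ne : inp ≠ []
  orig_mem : ∀ t, 1 ≤ t → t ≤ out.length → 1 ≤ orig t ∧ orig t ≤ inp.length

/-- `(g, g') ∈ ⟦R⟧` for the resynchronizer with language `γ`: same input and output,
and for some choice of input parameters, every output position has its `g`-origin
redirected to its `g'`-origin as allowed by `γ`. -/
def ResyncRel {Sig Gam : Type} {m : ℕ} (γ : Set (List (RLetter Sig m)))
    (g g' : OriginGraph Sig Gam) : Prop :=
  g.inp = g'.inp ∧ g.out = g'.out ∧
    ∃ I : Fin m → ℕ → Bool,
      ∀ z, 1 ≤ z → z ≤ g'.out.length → RSat γ g.inp I (g.orig z) (g'.orig z)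

/-- `S₁ ⊆ R(S₂)` for the resynchronizer with language `γ`. -/
def ContainedUpTo {Sig Gam : Type} {m : ℕ} (γ : Set (List (RLetter Sig m)))
    (S₁ S₂ : Set (OriginGraph Sig Gam)) : Prop :=
  ∀ g₁ ∈ S₁, ∃ g₂ ∈ S₂, ResyncRel γ g₂ g₁

/-- `S₁ ⪯ S₂`: there is a bounded regular resynchronizer `R` with `S₁ ⊆ R(S₂)`. -/
def ResyncLE {Sig Gam : Type} (S₁ S₂ : Set (OriginGraph Sig Gam)) : Prop :=
  ∃ (m : ℕ) (γ : Set (List (RLetter Sig m))),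
    IsRegularLang γ ∧ BoundedResync γ ∧ ContainedUpTo γ S₁ S₂

/-- Input position `x` traverses input position `z` (with respect to the pair `(g, g')`). -/
def Traverses {Sig Gam : Type} (g g' : OriginGraph Sig Gam) (x z : ℕ) : Prop :=
  ∃ t, 1 ≤ t ∧ t ≤ g.out.length ∧ g.orig t = x ∧
    ((x ≤ z ∧ z < g'.orig t) ∨ (g'.orig t < z ∧ z ≤ x))

/-- The pair `(g, g')` has `k`-traversal: every input position `z` is traversed by at
most `k` distinct positions. -/
def HasTraversal {Sig Gam : Type} (k : ℕ) (g g' : OriginGraph Sig Gam) : Prop :=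
  ∀ z, 1 ≤ z → z ≤ g.inp.length → {x : ℕ | Traverses g g' x z}.ncard ≤ k


/-! ### From a bounded resynchronizer to bounded traversal -/

theorem length_annot {Sig : Type} {m : ℕ} (u : List Sig) (I : Fin m → ℕ → Bool) (x y : ℕ) :
    (annot u I x y).length = u.length := by
  simp [annot]

theorem getElem_annot {Sig : Type} {m : ℕ} (u : List Sig) (I : Fin m → ℕ → Bool) (x y j : ℕ)
    (hj : j < (annot u I x y).length) :
    (annot u I x y)[j] = (u[j]'(by simpa [annot] using hj), fun i => I i (j + 1),
      decide (j + 1 = x), decide (j + 1 = y)) := by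
  simp [annot]

theorem take_annot_congr {Sig : Type} {m : ℕ} (u : List Sig) (I : Fin m → ℕ → Bool)
    {x y x' y' c : ℕ} (hx : ∀ j ≥ 1, j ≤ c → (j = x ↔ j = x'))
    (hy : ∀ j ≥ 1, j ≤ c → (j = y ↔ j = y')) :
    (annot u I x y).take c = (annot u I x' y').take c := by
  apply List.ext_getElem
  · simp [length_annot]
  · intro j h₁ h₂
    have hj : j + 1 ≤ c := by
      simp only [List.length_take] at h₁
      omega
    simp [getElem_annot, hx _ (Nat.le_add_left 1 j) hj, hy _ (Nat.le_add_left 1 j) hj]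

theorem drop_annot_congr {Sig : Type} {m : ℕ} (u : List Sig) (I : Fin m → ℕ → Bool)
    {x y x' y' c : ℕ} (hx : ∀ j > c, j = x ↔ j = x') (hy : ∀ j > c, j = y ↔ j = y') :
    (annot u I x y).drop c = (annot u I x' y').drop c := by
  apply List.ext_getElem
  · simp [length_annot]
  · intro j h₁ h₂
    have hj : c + j + 1 > c := by omega
    simp [getElem_annot, hx _ hj, hy _ hj]

theorem DFA.mem_accepts_iff_evalFrom_take_drop {α Q : Type} (M : DFA α Q) (w : List α) (c : ℕ) :
    w ∈ M.accepts ↔ M.evalFrom (M.eval (w.take c)) (w.drop c) ∈ M.accept := by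
  rw [DFA.mem_accepts]
  unfold DFA.eval
  rw [← DFA.evalFrom_of_append, List.take_append_drop]

/-- If a source position can be exchanged for any other one of the same class, and each target
admits at most `k` sources, then the number of sources is at most `k` times the number of
classes. -/
theorem ncard_le_of_exchange {C : Type} [Fintype C] {T : Set ℕ} (hT : T.Finite) (f : ℕ → C)
    {k : ℕ} {P : ℕ → Set ℕ} {Y : Set ℕ} (hP : ∀ y ∈ Y, (P y).Finite ∧ (P y).ncard ≤ k)
    (hex : ∀ x ∈ T, ∃ y ∈ Y, ∀ x' ∈ T, f x' = f x → x' ∈ P y) :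
    T.ncard ≤ k * Fintype.card C := by
  classical
  rw [Set.ncard_eq_toFinset_card T hT]
  refine (Finset.card_le_mul_card_image (f := f) hT.toFinset k ?_).trans
    (Nat.mul_le_mul_left _ (Finset.card_le_univ _))
  intro a ha
  obtain ⟨x, hx, rfl⟩ := Finset.mem_image.mp ha
  obtain ⟨y, hy, hxy⟩ := hex x (by simpa using hx)
  obtain ⟨hfin, hcard⟩ := hP y hy
  refine le_trans ?_ hcard
  rw [← Set.ncard_coe_finset]
  refine Set.ncard_le_ncard ?_ hfin
  intro x' hx'
  simp only [Finset.coe_filter, Set.Finite.mem_toFinset, Set.mem_ofPred_eq] at hx'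
  exact hxy x' hx'.1 hx'.2

theorem ncard_sources_left_le {Sig Q : Type} [Fintype Q] {m k : ℕ} (M : DFA (RLetter Sig m) Q)
    (hb : BoundedBy M.accepts k) (u : List Sig) (I : Fin m → ℕ → Bool) (c : ℕ) :
    {x | 1 ≤ x ∧ x ≤ u.length ∧ ∃ y ≤ u.length, x ≤ c ∧ c < y ∧
      RSat M.accepts u I x y}.ncard ≤ k * Fintype.card Q := by
  refine ncard_le_of_exchange (Y := {y | 1 ≤ y ∧ y ≤ u.length})
    (P := fun y => {x | 1 ≤ x ∧ x ≤ u.length ∧ RSat M.accepts u I x y})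
    ((Set.finite_le_nat u.length).subset fun x hx => hx.2.1)
    (fun x => M.eval ((annot u I x 0).take c))
    (fun y hy => ⟨(Set.finite_le_nat u.length).subset fun x hx => hx.2.1, hb u I y hy.1 hy.2⟩) ?_
  rintro x ⟨hx, hxu, y, hyu, hxc, hcy, hxy⟩
  refine ⟨y, ⟨by omega, hyu⟩, ?_⟩
  rintro x' ⟨hx', hxu', -, -, hxc', -, -⟩ heq
  refine ⟨hx', hxu', ?_⟩
  have key : ∀ s, 1 ≤ s → s ≤ c → (RSat M.accepts u I s y ↔
      M.evalFrom (M.eval ((annot u I s 0).take c)) ((annot u I 0 y).drop c) ∈ M.accept) := by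
    intro s hs hsc
    refine (DFA.mem_accepts_iff_evalFrom_take_drop M _ c).trans ?_
    rw [take_annot_congr u I (x := s) (x' := s) (y := y) (y' := c + 1)
        (by intros; omega) (by intros; omega),
      take_annot_congr u I (x := s) (x' := s) (y := 0) (y' := c + 1)
        (by intros; omega) (by intros; omega),
      drop_annot_congr u I (x := s) (x' := 0) (y := y) (y' := y)
        (by intros; omega) (by intros; omega)]
  rw [key x hx hxc, ← heq] at hxy
  exact (key x' hx' hxc').2 hxy

theorem ncard_sources_right_le {Sig Q : Type} [Fintype Q] {m k : ℕ} (M : DFA (RLetter Sig m) Q)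
    (hb : BoundedBy M.accepts k) (u : List Sig) (I : Fin m → ℕ → Bool) (c : ℕ) :
    {x | 1 ≤ x ∧ x ≤ u.length ∧ ∃ y ≤ u.length, 1 ≤ y ∧ y ≤ c ∧ c < x ∧
      RSat M.accepts u I x y}.ncard ≤ k * 2 ^ Fintype.card Q := by
  classical
  rw [← Fintype.card_set]
  refine ncard_le_of_exchange (Y := {y | 1 ≤ y ∧ y ≤ u.length})
    (P := fun y => {x | 1 ≤ x ∧ x ≤ u.length ∧ RSat M.accepts u I x y})
    ((Set.finite_le_nat u.length).subset fun x hx => hx.2.1)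
    (fun x => {s | M.evalFrom s ((annot u I x 0).drop c) ∈ M.accept})
    (fun y hy => ⟨(Set.finite_le_nat u.length).subset fun x hx => hx.2.1, hb u I y hy.1 hy.2⟩) ?_
  rintro x ⟨hx, hxu, y, hyu, hy, hyc, hcx, hxy⟩
  refine ⟨y, ⟨hy, hyu⟩, ?_⟩
  rintro x' ⟨hx', hxu', -, -, -, -, hcx', -⟩ heq
  refine ⟨hx', hxu', ?_⟩
  have key : ∀ s, c < s → (RSat M.accepts u I s y ↔
      M.eval ((annot u I (c + 1) y).take c) ∈
        {q | M.evalFrom q ((annot u I s 0).drop c) ∈ M.accept}) := by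
    intro s hcs
    refine (DFA.mem_accepts_iff_evalFrom_take_drop M _ c).trans ?_
    rw [take_annot_congr u I (x := s) (x' := c + 1) (y := y) (y' := y)
        (by intros; omega) (by intros; omega),
      drop_annot_congr u I (x := s) (x' := s) (y := y) (y' := 0)
        (by intros; omega) (by intros; omega)]
    rfl
  rw [key x hcx, ← heq] at hxy
  exact (key x' hcx').2 hxy

theorem ResyncRel.hasTraversal {Sig Gam Q : Type} [Fintype Q] {m k : ℕ}
    {M : DFA (RLetter Sig m) Q} (hb : BoundedBy M.accepts k) {g g' : OriginGraph Sig Gam}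
    (h : ResyncRel M.accepts g g') :
    HasTraversal (k * Fintype.card Q + k * 2 ^ Fintype.card Q) g g' := by
  obtain ⟨hinp, hout, I, hI⟩ := h
  intro z hz hzu
  refine le_trans (Set.ncard_le_ncard ?_ ?_) ((Set.ncard_union_le _ _).trans
    (add_le_add (ncard_sources_left_le M hb g.inp I z)
      (ncard_sources_right_le M hb g.inp I (z - 1))))
  · rintro x ⟨t, ht, htl, rfl, h⟩
    have hs := g.orig_mem t ht htl
    have hs' := g'.orig_mem t ht (hout ▸ htl)
    rw [← hinp] at hs'
    have hsat := hI t ht (hout ▸ htl)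
    rcases h with h | h
    · exact Or.inl ⟨hs.1, hs.2, g'.orig t, hs'.2, h.1, h.2, hsat⟩
    · exact Or.inr ⟨hs.1, hs.2, g'.orig t, hs'.2, hs'.1, by omega, by omega, hsat⟩
  · refine (Set.finite_le_nat g.inp.length).subset ?_
    rintro x (hx | hx) <;> exact hx.2.1

/-! ### From bounded traversal to a bounded resynchronizer -/

/-- Greedy colouring along a well-founded relation with bounded in-degree. -/
theorem WellFounded.exists_coloring {α : Type} {r : α → α → Prop} (hr : WellFounded r) {k : ℕ}
    (hk : ∀ x, {x' | r x' x}.Finite ∧ {x' | r x' x}.ncard ≤ k) :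
    ∃ col : α → Fin (k + 1), ∀ x' x, r x' x → col x' ≠ col x := by
  classical
  have hfree : ∀ (x : α) (col : ∀ x', r x' x → Fin (k + 1)),
      ∃ i, ∀ x' (h : r x' x), col x' h ≠ i := by
    intro x col
    by_contra! hcon
    choose f hf hfi using hcon
    have hinj : Function.Injective f := by
      intro i j hij
      rw [← hfi i, ← hfi j]
      congr 1
    have h₁ : (Set.range f).ncard ≤ k :=
      (Set.ncard_le_ncard (by rintro _ ⟨i, rfl⟩; exact hf i) (hk x).1).trans (hk x).2
    rw [← Set.image_univ, Set.ncard_image_of_injective _ hinj, Set.ncard_univ,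
      Nat.card_eq_fintype_card, Fintype.card_fin] at h₁
    omega
  refine ⟨hr.fix fun x col => (hfree x col).choose, fun x' x h => ?_⟩
  conv_rhs => rw [hr.fix_eq]
  exact (hfree x fun x' _ => hr.fix (fun x col => (hfree x col).choose) x').choose_spec x' h

/-- Words containing, for some `i`, positions `p ≤ q` such that `p` satisfies `A i`, `q` satisfies
`B i`, and every position strictly in between satisfies `C i`. -/
def factorLang {α ι : Type} (A B C : ι → α → Prop) : Set (List α) :=
  {w | ∃ (i : ι) (p q : ℕ), p ≤ q ∧ (∃ a ∈ w[p]?, A i a) ∧ (∃ b ∈ w[q]?, B i b) ∧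
    ∀ r, p < r → r < q → ∀ c ∈ w[r]?, C i c}

/-- The automaton that tracks, for every `i`, whether a factor for `i` has been completed and
whether one is currently open. -/
def factorDFA {α ι : Type} (A B C : ι → α → Prop) : DFA α (ι → Prop × Prop) where
  step s a i := ((s i).1 ∨ (s i).2 ∧ B i a ∨ A i a ∧ B i a, (s i).2 ∧ C i a ∨ A i a)
  start _ := (False, False)
  accept := {s | ∃ i, (s i).1}

theorem factorDFA_eval_iff {α ι : Type} (A B C : ι → α → Prop) (w : List α) (i : ι) :
    (((factorDFA A B C).eval w i).1 ↔ ∃ p q : ℕ, p ≤ q ∧ (∃ a ∈ w[p]?, A i a) ∧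
        (∃ b ∈ w[q]?, B i b) ∧ ∀ r, p < r → r < q → ∀ c ∈ w[r]?, C i c) ∧
      (((factorDFA A B C).eval w i).2 ↔ ∃ p : ℕ, (∃ a ∈ w[p]?, A i a) ∧
        ∀ r, p < r → ∀ c ∈ w[r]?, C i c) := by
  induction w using List.reverseRecOn with
  | nil => simp [factorDFA]
  | append_singleton w d ih =>
    obtain ⟨ih₁, ih₂⟩ := ih
    rw [DFA.eval_append_singleton]
    have hlt : ∀ {p}, p < w.length → (w ++ [d])[p]? = w[p]? := fun h =>
      List.getElem?_append_left h
    have heq : (w ++ [d])[w.length]? = some d := by simp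
    have hgt : ∀ {p}, w.length < p → (w ++ [d])[p]? = none := fun h => by
      simp; omega
    have hge : ∀ {p}, w.length ≤ p → w[p]? = none := fun h => by simpa using h
    constructor
    · change _ ∨ _ ↔ _
      rw [ih₁, ih₂]
      constructor
      · rintro (⟨p, q, hpq, ha, hb, hc⟩ | ⟨⟨p, ha, hc⟩, hB⟩ | ⟨hA, hB⟩)
        · have hq : q < w.length := by
            by_contra! h
            simp [hge h] at hb
          refine ⟨p, q, hpq, by rwa [hlt (by omega)], by rwa [hlt hq], fun r h₁ h₂ => ?_⟩
          rw [hlt (by omega)]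
          exact hc r h₁ h₂
        · have hp : p < w.length := by
            by_contra! h
            simp [hge h] at ha
          refine ⟨p, w.length, hp.le, by rwa [hlt hp], by simpa using hB, fun r h₁ h₂ => ?_⟩
          rw [hlt h₂]
          exact hc r h₁
        · exact ⟨w.length, w.length, le_rfl, by simpa using hA, by simpa using hB,
            fun r h₁ h₂ => by omega⟩
      · rintro ⟨p, q, hpq, ha, hb, hc⟩
        rcases lt_trichotomy q w.length with hq | rfl | hq
        · refine Or.inl ⟨p, q, hpq, by rwa [hlt (by omega)] at ha, by rwa [hlt hq] at hb,
            fun r h₁ h₂ => ?_⟩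
          rw [← hlt (by omega)]
          exact hc r h₁ h₂
        · right
          have hB : B i d := by simpa using hb
          rcases hpq.lt_or_eq with hp | rfl
          · refine Or.inl ⟨⟨p, by rwa [hlt hp] at ha, fun r h₁ => ?_⟩, hB⟩
            rcases lt_or_ge r w.length with hr | hr
            · rw [← hlt hr]
              exact hc r h₁ hr
            · simp [hge hr]
          · exact Or.inr ⟨by simpa using ha, hB⟩
        · simp [hgt hq] at hb
    · change _ ∨ _ ↔ _
      rw [ih₂]
      constructor
      · rintro (⟨⟨p, ha, hc⟩, hC⟩ | hA)
        · have hp : p < w.length := by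
            by_contra! h
            simp [hge h] at ha
          refine ⟨p, by rwa [hlt hp], fun r h₁ => ?_⟩
          rcases lt_trichotomy r w.length with hr | rfl | hr
          · rw [hlt hr]
            exact hc r h₁
          · simpa using hC
          · simp [hgt hr]
        · exact ⟨w.length, by simpa using hA, fun r h₁ => by simp [hgt h₁]⟩
      · rintro ⟨p, ha, hc⟩
        rcases lt_trichotomy p w.length with hp | rfl | hp
        · refine Or.inl ⟨⟨p, by rwa [hlt hp] at ha, fun r h₁ => ?_⟩, ?_⟩
          · rcases lt_or_ge r w.length with hr | hr
            · rw [← hlt hr]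
              exact hc r h₁
            · simp [hge hr]
          · simpa using hc w.length hp
        · exact Or.inr (by simpa using ha)
        · simp [hgt hp] at ha

theorem isRegularLang_factorLang {α ι : Type} [Finite ι] (A B C : ι → α → Prop) :
    IsRegularLang (factorLang A B C) := by
  classical
  have := Fintype.ofFinite ι
  refine ⟨_, inferInstance, factorDFA A B C, ?_⟩
  ext w
  exact exists_congr fun i => (factorDFA_eval_iff A B C w i).1

/-- The resynchronizer that redirects a source `x` to a target `y` when, for some parameter `i`,
the position `x` carries `i` and no position strictly between `x` and `y` does. -/
def nearestColorLang (Sig : Type) (m : ℕ) : Set (List (RLetter Sig m)) :=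
  factorLang (ι := Fin m × Bool)
    (fun i a => if i.2 then a.2.2.1 = true ∧ a.2.1 i.1 = true else a.2.2.2 = true)
    (fun i a => if i.2 then a.2.2.2 = true else a.2.2.1 = true ∧ a.2.1 i.1 = true)
    (fun i a => a.2.1 i.1 = false)

theorem exists_mem_getElem?_annot {Sig : Type} {m : ℕ} {u : List Sig} {I : Fin m → ℕ → Bool}
    {x y p : ℕ} {P : (Fin m → Bool) → Bool → Bool → Prop} :
    (∃ a ∈ (annot u I x y)[p]?, P a.2.1 a.2.2.1 a.2.2.2) ↔
      p < u.length ∧ P (fun i => I i (p + 1)) (decide (p + 1 = x)) (decide (p + 1 = y)) := by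
  rcases lt_or_ge p u.length with hp | hp
  · simp [annot, hp]
  · simp [annot, hp]

theorem rSat_nearestColorLang {Sig : Type} {m : ℕ} {u : List Sig} {I : Fin m → ℕ → Bool}
    {x y : ℕ} (hx : 1 ≤ x) (hxu : x ≤ u.length) (hy : 1 ≤ y) (hyu : y ≤ u.length) :
    RSat (nearestColorLang Sig m) u I x y ↔ ∃ i, I i x = true ∧
      ((x ≤ y ∧ ∀ r, x < r → r < y → I i r = false) ∨
        (y ≤ x ∧ ∀ r, y < r → r < x → I i r = false)) := by
  obtain ⟨x, rfl⟩ := Nat.exists_eq_add_of_le' hx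
  obtain ⟨y, rfl⟩ := Nat.exists_eq_add_of_le' hy
  have hbetween : ∀ {p q : ℕ} {i : Fin m}, q < u.length →
      ((∀ r, p < r → r < q → ∀ c ∈ (annot u I (x + 1) (y + 1))[r]?, c.2.1 i = false) ↔
        ∀ r, p + 1 < r → r < q + 1 → I i r = false) := by
    intro p q i hq
    constructor
    · intro h r h₁ h₂
      obtain ⟨r, rfl⟩ := Nat.exists_eq_add_of_le' (show 1 ≤ r by omega)
      have hr : r < u.length := by omega
      simpa [annot, hr] using h r (by omega) (by omega)
    · intro h r h₁ h₂
      have hr : r < u.length := by omega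
      simpa [annot, hr] using h (r + 1) (by omega) (by omega)
  have hX : ∀ {p : ℕ} {i : Fin m}, (∃ a ∈ (annot u I (x + 1) (y + 1))[p]?,
      a.2.2.1 = true ∧ a.2.1 i = true) ↔ p = x ∧ I i (x + 1) = true := by
    intro p i
    rw [exists_mem_getElem?_annot (P := fun c s _ => s = true ∧ c i = true)]
    simp only [decide_eq_true_eq, add_left_inj]
    constructor
    · rintro ⟨-, rfl, h⟩
      exact ⟨rfl, h⟩
    · rintro ⟨rfl, h⟩
      exact ⟨by omega, rfl, h⟩
  have hY : ∀ {p : ℕ}, (∃ a ∈ (annot u I (x + 1) (y + 1))[p]?, a.2.2.2 = true) ↔ p = y := by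
    intro p
    rw [exists_mem_getElem?_annot (P := fun _ _ t => t = true)]
    simp only [decide_eq_true_eq, add_left_inj]
    omega
  constructor
  · rintro ⟨⟨i, b⟩, p, q, hpq, ha, hb, hc⟩
    cases b
    · simp only [Bool.false_eq_true, if_false] at ha hb
      obtain rfl := hY.1 ha
      obtain ⟨rfl, hi⟩ := hX.1 hb
      exact ⟨i, hi, Or.inr ⟨by omega, (hbetween (by omega)).1 hc⟩⟩
    · simp only [if_true] at ha hb
      obtain rfl := hY.1 hb
      obtain ⟨rfl, hi⟩ := hX.1 ha
      exact ⟨i, hi, Or.inl ⟨by omega, (hbetween (by omega)).1 hc⟩⟩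
  · rintro ⟨i, hi, ⟨hxy, hc⟩ | ⟨hxy, hc⟩⟩
    · exact ⟨(i, true), x, y, by omega, by simpa using hX.2 ⟨rfl, hi⟩, by simpa using hY.2 rfl,
        (hbetween (by omega)).2 hc⟩
    · exact ⟨(i, false), y, x, by omega, by simpa using hY.2 rfl, by simpa using hX.2 ⟨rfl, hi⟩,
        (hbetween (by omega)).2 hc⟩

theorem boundedResync_nearestColorLang (Sig : Type) (m : ℕ) :
    BoundedResync (nearestColorLang Sig m) := by
  classical
  refine ⟨Fintype.card (Fin m × Bool × Bool), fun u I y hy hyu => ?_⟩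
  set S := {x : ℕ | 1 ≤ x ∧ x ≤ u.length ∧ RSat (nearestColorLang Sig m) u I x y} with hS
  have hsat : ∀ x : S, ∃ i, I i x = true ∧
      ((x ≤ y ∧ ∀ r : ℕ, x < r → r < y → I i r = false) ∨
        (y ≤ x ∧ ∀ r : ℕ, y < r → r < x → I i r = false)) := fun x =>
    (rSat_nearestColorLang x.2.1 x.2.2.1 hy hyu).1 x.2.2.2
  choose col hcol hnear using hsat
  have hinj : Function.Injective fun x : S => (col x, decide (x < y), decide ((x : ℕ) = y)) := by
    intro x x' h
    simp only [Prod.mk.injEq, decide_eq_decide] at h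
    obtain ⟨hc, hlt, heq⟩ := h
    have hx := hnear x
    have hx' := hnear x'
    have cx := hcol x
    have cx' := hcol x'
    rw [hc] at hx cx
    have h₁ : ¬ (x : ℕ) < x' := by
      intro hlt'
      rcases hx with ⟨_, hx⟩ | ⟨_, hx⟩ <;> rcases hx' with ⟨_, hx'⟩ | ⟨_, hx'⟩ <;> grind
    have h₂ : ¬ (x' : ℕ) < x := by
      intro hlt'
      rcases hx with ⟨_, hx⟩ | ⟨_, hx⟩ <;> rcases hx' with ⟨_, hx'⟩ | ⟨_, hx'⟩ <;> grind
    exact Subtype.ext (by omega)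
  have := Nat.card_le_card_of_injective _ hinj
  rwa [Nat.card_coe_set_eq, Nat.card_eq_fintype_card] at this

theorem finite_setOf_traverses {Sig Gam : Type} (g g' : OriginGraph Sig Gam) (z : ℕ) :
    {x | Traverses g g' x z}.Finite := by
  refine (Set.finite_le_nat g.inp.length).subset ?_
  rintro x ⟨t, ht, htl, rfl, -⟩
  exact (g.orig_mem t ht htl).2

theorem HasTraversal.resyncRel {Sig Gam : Type} {k : ℕ} {g g' : OriginGraph Sig Gam}
    (hinp : g.inp = g'.inp) (hout : g.out = g'.out) (h : HasTraversal k g g') :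
    ResyncRel (nearestColorLang Sig ((k + 1) + (k + 1))) g g' := by
  have hbound : ∀ (r : ℕ → ℕ → Prop), (∀ x' x, r x' x → 1 ≤ x ∧ x ≤ g.inp.length ∧
      Traverses g g' x' x) → ∀ x, {x' | r x' x}.Finite ∧ {x' | r x' x}.ncard ≤ k := by
    intro r hr x
    have hsub : {x' | r x' x} ⊆ {x' | Traverses g g' x' x} := fun x' hx' => (hr x' x hx').2.2
    refine ⟨(finite_setOf_traverses g g' x).subset hsub, ?_⟩
    rcases Set.eq_empty_or_nonempty {x' | r x' x} with he | ⟨x', hx'⟩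
    · simp [he]
    · exact (Set.ncard_le_ncard hsub (finite_setOf_traverses g g' x)).trans
        (h x (hr x' x hx').1 (hr x' x hx').2.1)
  obtain ⟨colR, hR⟩ := WellFounded.exists_coloring (k := k)
    (r := fun x' x => x' < x ∧ 1 ≤ x ∧ x ≤ g.inp.length ∧ Traverses g g' x' x)
    (Subrelation.wf (fun h => h.1) (wellFounded_lt (α := ℕ)))
    (hbound _ fun x' x h => h.2)
  obtain ⟨colL, hL⟩ := WellFounded.exists_coloring (k := k)
    (r := fun x' x => (x < x' ∧ x' ≤ g.inp.length) ∧ 1 ≤ x ∧ x ≤ g.inp.length ∧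
      Traverses g g' x' x)
    (Subrelation.wf (r := InvImage (· < ·) fun x => g.inp.length - x)
      (fun h => show g.inp.length - _ < g.inp.length - _ by have := h.1; omega) (InvImage.wf _ wellFounded_lt))
    (hbound _ fun x' x h => h.2)
  refine ⟨hinp, hout, fun i p => Fin.addCases (fun c => decide (colR p = c))
    (fun c => decide (colL p = c)) i, fun t ht htl => ?_⟩
  have htl' : t ≤ g.out.length := hout ▸ htl
  obtain ⟨hx, hxu⟩ := g.orig_mem t ht htl'
  obtain ⟨hy, hyu⟩ := g'.orig_mem t ht htl
  rw [← hinp] at hyu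
  rw [rSat_nearestColorLang hx hxu hy hyu]
  rcases le_total (g.orig t) (g'.orig t) with hxy | hxy
  · refine ⟨Fin.castAdd _ (colR (g.orig t)), by simp, Or.inl ⟨hxy, fun r h₁ h₂ => ?_⟩⟩
    simpa using (hR _ r ⟨h₁, by omega, by omega, t, ht, htl', rfl, Or.inl ⟨h₁.le, h₂⟩⟩).symm
  · refine ⟨Fin.natAdd _ (colL (g.orig t)), by simp only [Fin.addCases_right, decide_true], Or.inr ⟨hxy, fun r h₁ h₂ => ?_⟩⟩
    simpa only [Fin.addCases_right, decide_eq_false_iff_not] using (hL _ r ⟨⟨h₂, hxu⟩, by omega, by omega, t, ht, htl', rfl,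
      Or.inr ⟨h₁, h₂.le⟩⟩).symm

/-- Characterization of containment up to an unknown bounded regular resynchronizer:
`S₁ ⪯ S₂` iff there is `k` such that every origin graph of `S₁` is matched by an origin
graph of `S₂` with the same input and output such that the pair has `k`-traversal. -/
theorem resyncLE_iff_limitedTraversal (Sig Gam : Type) [Fintype Sig] [Fintype Gam]
    (S₁ S₂ : Set (OriginGraph Sig Gam)) :
    ResyncLE S₁ S₂ ↔
      ∃ k : ℕ, ∀ g' ∈ S₁, ∃ g ∈ S₂,
        g.inp = g'.inp ∧ g.out = g'.out ∧ HasTraversal k g g' := by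
  constructor
  · rintro ⟨m, γ, ⟨Q, _, M, rfl⟩, ⟨k, hk⟩, hsub⟩
    refine ⟨k * Fintype.card Q + k * 2 ^ Fintype.card Q, fun g' hg' => ?_⟩
    obtain ⟨g, hg, hrel⟩ := hsub g' hg'
    exact ⟨g, hg, hrel.1, hrel.2.1, hrel.hasTraversal hk⟩
  · rintro ⟨k, hk⟩
    refine ⟨(k + 1) + (k + 1), nearestColorLang Sig _, isRegularLang_factorLang _ _ _,
      boundedResync_nearestColorLang _ _, fun g' hg' => ?_⟩
    obtain ⟨g, hg, hinp, hout, htr⟩ := hk g' hg'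
    exact ⟨g, hg, htr.resyncRel hinp hout⟩
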